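/- Let u ∈ C_c^∞(ℝ³), y₀ ∈ ℝ³, and ε > 0. Then for every λ > 0: | ∫_{ℝ³} ((e^{iλ|y − y₀/ε|} − e^{−iλ|y − y₀/ε|})/(4π|y − y₀/ε|)) u(y) dy | ≤ C_u ⟨λ⟩^{−2} ∫_{supp u} |y − y₀/ε|^{−1} dy, where C_u depends only on u (via ‖u‖_∞ and ‖Δu‖_∞ and the measure of supp u) and not on ε or λ, and ⟨λ⟩ = (1+λ²)^{1/2}. -/

import Mathlib

open MeasureTheory


theorem exists_G : ∃ G : ℂ → ℂ, Differentiable ℂ G ∧ ∀ z, z * G (z ^ 2) = Complex.sin z := by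
  refine ⟨fun w => ∑' n : ℕ, (-1) ^ n * w ^ n / ((2 * n + 1).factorial : ℂ), ?_, ?_⟩
  · intro w
    have h := Complex.differentiableOn_tsum_of_summable_norm
      (F := fun (n : ℕ) (w : ℂ) => (-1) ^ n * w ^ n / ((2 * n + 1).factorial : ℂ))
      (U := Metric.ball 0 (‖w‖ + 1)) (Real.summable_pow_div_factorial (‖w‖ + 1))
      (fun i => by fun_prop) Metric.isOpen_ball ?_
    · exact (h.differentiableAt (Metric.isOpen_ball.mem_nhds (by simp)))
    · intro n v hv
      have hv' : ‖v‖ ≤ ‖w‖ + 1 := by simpa using (le_of_lt (by simpa using hv : ‖v‖ < ‖w‖ + 1))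
      simp only [norm_div, norm_mul, norm_pow, norm_neg, norm_one, one_pow, one_mul,
        Complex.norm_natCast]
      gcongr
      omega
  · intro z
    rw [← (Complex.hasSum_sin z).tsum_eq, ← tsum_mul_left]
    congr 1
    ext n
    ring

theorem ode_G {G : ℂ → ℂ} (hG : Differentiable ℂ G) (h : ∀ z, z * G (z ^ 2) = Complex.sin z)
    (z : ℂ) (hz : z ≠ 0) :
    6 * deriv G (z ^ 2) + 4 * z ^ 2 * deriv (deriv G) (z ^ 2) + G (z ^ 2) = 0 := by
  have hG' : Differentiable ℂ (deriv G) := by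
    intro w
    exact (hG.analyticAt w).deriv.differentiableAt
  have hsq : ∀ z : ℂ, HasDerivAt (fun z : ℂ => z ^ 2) (2 * z) z := fun z => by
    simpa using hasDerivAt_pow 2 z
  have h1 : ∀ z, G (z ^ 2) + z * (deriv G (z ^ 2) * (2 * z)) = Complex.cos z := by
    intro z
    have a := (hasDerivAt_id z).mul ((hG (z ^ 2)).hasDerivAt.comp z (hsq z))
    have b : HasDerivAt (id * (G ∘ fun z : ℂ => z ^ 2)) (Complex.cos z) z := by
      have : (id * (G ∘ fun z : ℂ => z ^ 2)) = Complex.sin := by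
        ext z; simpa using h z
      rw [this]; exact Complex.hasDerivAt_sin z
    have := a.unique b
    simpa using this
  have a := ((hG (z ^ 2)).hasDerivAt.comp z (hsq z)).add
    ((hasDerivAt_id z).mul (((hG' (z ^ 2)).hasDerivAt.comp z (hsq z)).mul
      ((hasDerivAt_id z).const_mul 2)))
  have b : HasDerivAt (fun z => G (z ^ 2) + z * (deriv G (z ^ 2) * (2 * z)))
      (-Complex.sin z) z := by
    rw [funext h1]; exact Complex.hasDerivAt_cos z
  have c := a.unique b
  rw [← h z] at c
  simp at c
  apply mul_left_cancel₀ hz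
  linear_combination c

theorem intOn_inv (c : (EuclideanSpace ℝ (Fin 3))) (s : Set (EuclideanSpace ℝ (Fin 3))) (hs : IsCompact s) :
    IntegrableOn (fun y : (EuclideanSpace ℝ (Fin 3)) => ‖y - c‖⁻¹) s := by
  obtain ⟨R, hR⟩ := hs.isBounded.subset_ball c
  refine IntegrableOn.mono_set ?_ hR
  have h0 : Integrable (fun y : (EuclideanSpace ℝ (Fin 3)) => (Set.Iio R).indicator (fun r : ℝ => r⁻¹) ‖y‖) := by
    rw [integrable_fun_norm_addHaar volume (f := (Set.Iio R).indicator (fun r : ℝ => r⁻¹))]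
    have : IntegrableOn ((Set.Iio R).indicator (fun r : ℝ => r)) (Set.Ioi 0) := by
      rw [integrableOn_indicator_iff measurableSet_Iio]
      exact ((continuous_id.integrableOn_Icc (a := 0) (b := R))).mono_set
        (fun x hx => ⟨hx.2.le, hx.1.le⟩)
    refine this.congr_fun ?_ measurableSet_Ioi
    intro x hx
    have hx' : x ≠ 0 := ne_of_gt hx
    by_cases hxr : x < R <;> simp [hxr]
    field_simp
  have h1 := h0.comp_sub_right c
  rw [← integrable_indicator_iff measurableSet_ball]
  refine h1.congr (Filter.Eventually.of_forall fun y => ?_)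
  by_cases hy : ‖y - c‖ < R <;> simp [Set.indicator, hy, dist_eq_norm]

theorem parts {F u : (EuclideanSpace ℝ (Fin 3)) → ℂ} (hF : ContDiff ℝ 2 F) (hu : ContDiff ℝ 2 u)
    (hsupp : HasCompactSupport u) (v : (EuclideanSpace ℝ (Fin 3))) :
    ∫ y, F y * fderiv ℝ (fun x => fderiv ℝ u x v) y v =
    ∫ y, fderiv ℝ (fun x => fderiv ℝ F x v) y v * u y := by
  have d1 : ∀ {f : (EuclideanSpace ℝ (Fin 3)) → ℂ}, ContDiff ℝ 2 f → ContDiff ℝ 1 (fun x => fderiv ℝ f x v) := fun hf =>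
    (hf.fderiv_right (m := 1) (by norm_num)).clm_apply contDiff_const
  have d2 : ∀ {f : (EuclideanSpace ℝ (Fin 3)) → ℂ}, ContDiff ℝ 1 f → Continuous (fun x => fderiv ℝ f x v) := fun hf =>
    (hf.continuous_fderiv (by norm_num)).clm_apply continuous_const
  have s1 : HasCompactSupport (fun x => fderiv ℝ u x v) := hsupp.fderiv_apply ℝ v
  have s2 : HasCompactSupport (fun y => fderiv ℝ (fun x => fderiv ℝ u x v) y v) :=
    s1.fderiv_apply ℝ v
  have int : ∀ {f g : (EuclideanSpace ℝ (Fin 3)) → ℂ}, Continuous f → Continuous g → HasCompactSupport g →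
      Integrable (fun y => f y * g y) := fun hf hg hs =>
    (hf.mul hg).integrable_of_hasCompactSupport hs.mul_left
  have hF1 := d1 hF
  have hu1 := d1 hu
  have hFo : ContDiff ℝ 1 F := hF.of_le (by norm_num)
  have huo : ContDiff ℝ 1 u := hu.of_le (by norm_num)
  rw [integral_mul_fderiv_eq_neg_fderiv_mul_of_integrable
    (int hF1.continuous hu1.continuous s1) (int hF.continuous (d2 hu1) s2)
    (int hF.continuous hu1.continuous s1)
    (fun x _ => hF.differentiable (by norm_num) x) (fun x _ => hu1.differentiable (by norm_num) x),
    integral_mul_fderiv_eq_neg_fderiv_mul_of_integrable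
    (int (d2 hF1) hu.continuous hsupp) (int hF1.continuous hu1.continuous s1)
    (int hF1.continuous hu.continuous hsupp)
    (fun x _ => hF1.differentiable (by norm_num) x) (fun x _ => hu.differentiable (by norm_num) x),
    neg_neg]

noncomputable def qq (l : ℝ) (c y : (EuclideanSpace ℝ (Fin 3))) : ℂ := ((l ^ 2 * ‖y - c‖ ^ 2 : ℝ) : ℂ)

theorem qq_contDiff (l : ℝ) (c : (EuclideanSpace ℝ (Fin 3))) : ContDiff ℝ 2 (qq l c) := by
  unfold qq
  refine Complex.ofRealCLM.contDiff.comp (contDiff_const.mul ?_)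
  exact (contDiff_id.sub contDiff_const).norm_sq ℝ

theorem qq_deriv (l : ℝ) (c y v : (EuclideanSpace ℝ (Fin 3))) :
    HasFDerivAt (qq l c) (Complex.ofRealCLM ∘L ((l ^ 2) • (2 • (innerSL ℝ (y - c))))) y := by
  have h : HasFDerivAt (fun y : (EuclideanSpace ℝ (Fin 3)) => ‖y - c‖ ^ 2) (2 • (innerSL ℝ (y - c))) y := by
    simpa using ((hasFDerivAt_id y).sub_const c).norm_sq
  exact Complex.ofRealCLM.hasFDerivAt.comp y (h.const_mul (l ^ 2))

theorem comp_deriv {G : ℂ → ℂ} (hG : Differentiable ℂ G) (l : ℝ) (c y v : (EuclideanSpace ℝ (Fin 3))) :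
    HasFDerivAt (fun y => G (qq l c y))
      ((deriv G (qq l c y)) • (Complex.ofRealCLM ∘L ((l ^ 2) • (2 • (innerSL ℝ (y - c)))))) y := by
  exact (hG _).hasDerivAt.comp_hasFDerivAt y (qq_deriv l c y v)

theorem second {G : ℂ → ℂ} (hG : Differentiable ℂ G) (l : ℝ) (c y v : (EuclideanSpace ℝ (Fin 3))) :
    fderiv ℝ (fun x => fderiv ℝ (fun y => G (qq l c y)) x v) y v =
      deriv (deriv G) (qq l c y) * (4 * l ^ 4 * (inner ℝ (y - c) v : ℝ) ^ 2)
       + deriv G (qq l c y) * (2 * l ^ 2 * (inner ℝ v v : ℝ)) := by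
  have hG' : Differentiable ℂ (deriv G) := fun w => (hG.analyticAt w).deriv.differentiableAt
  have e : (fun x => fderiv ℝ (fun y => G (qq l c y)) x v) =
      fun x => deriv G (qq l c x) * ((l ^ 2 * (2 * inner ℝ (x - c) v) : ℝ) : ℂ) := by
    ext x
    rw [(comp_deriv hG l c x v).fderiv]
    simp [inner_sub_left]
  have h2 : HasFDerivAt (fun x : (EuclideanSpace ℝ (Fin 3)) => ((l ^ 2 * (2 * inner ℝ (x - c) v) : ℝ) : ℂ))
      (Complex.ofRealCLM ∘L ((l ^ 2) • ((2:ℝ) • (innerSL ℝ v)))) y := by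
    have h3 : HasFDerivAt (fun x : (EuclideanSpace ℝ (Fin 3)) => (inner ℝ (x - c) v : ℝ)) (innerSL ℝ v) y := by
      have := (innerSL ℝ v).hasFDerivAt.comp y ((hasFDerivAt_id y).sub_const c)
      refine this.congr_of_eventuallyEq (Filter.Eventually.of_forall fun x => ?_)
      simp [real_inner_comm]
    exact Complex.ofRealCLM.hasFDerivAt.comp y ((h3.const_mul 2).const_mul (l ^ 2))
  have h4 := ((comp_deriv hG' l c y v).fun_mul h2).fderiv
  rw [e, h4]
  simp [-inner_self_eq_norm_sq_to_K, inner_sub_left]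
  ring

theorem lap {G : ℂ → ℂ} (hG : Differentiable ℂ G) (h : ∀ z, z * G (z ^ 2) = Complex.sin z)
    (l : ℝ) (hl : 0 < l) (c y : (EuclideanSpace ℝ (Fin 3))) (hy : y ≠ c) :
    ∑ i : Fin 3, fderiv ℝ (fun x => fderiv ℝ (fun y => G (qq l c y)) x
      (EuclideanSpace.single i 1)) y (EuclideanSpace.single i 1) = - l ^ 2 * G (qq l c y) := by
  have hn : ‖y - c‖ ≠ 0 := by simpa [sub_eq_zero] using hy
  have o := ode_G hG h ((l * ‖y - c‖ : ℝ) : ℂ) (by exact_mod_cast mul_ne_zero hl.ne' hn)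
  have q : (((l * ‖y - c‖ : ℝ) : ℂ)) ^ 2 = qq l c y := by simp [qq]; ring
  rw [q] at o
  have n : qq l c y = l ^ 2 * (((y 0 - c 0 : ℝ) : ℂ) ^ 2 + ((y 1 - c 1 : ℝ) : ℂ) ^ 2 +
    ((y 2 - c 2 : ℝ) : ℂ) ^ 2) := by
    rw [qq, EuclideanSpace.norm_sq_eq, Fin.sum_univ_three]
    simp
  simp only [second hG, Fin.sum_univ_three]
  simp only [EuclideanSpace.inner_single_right, real_inner_self_eq_norm_sq] 
  simp
  simp at n
  linear_combination l ^ 2 * o - 4 * l ^ 2 * deriv (deriv G) (qq l c y) * n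


noncomputable def KK (l : ℝ) (c y : (EuclideanSpace ℝ (Fin 3))) : ℂ :=
  (Complex.exp (Complex.I * (l : ℂ) * ((‖y - c‖ : ℝ) : ℂ)) -
              Complex.exp (-(Complex.I * (l : ℂ) * ((‖y - c‖ : ℝ) : ℂ))))
            / (((4 * Real.pi : ℝ) : ℂ) * ((‖y - c‖ : ℝ) : ℂ))

theorem KK_norm (l : ℝ) (c y : (EuclideanSpace ℝ (Fin 3))) : ‖KK l c y‖ ≤ ‖y - c‖⁻¹ := by
  have e1 : ‖Complex.exp (Complex.I * (l : ℂ) * ((‖y - c‖ : ℝ) : ℂ))‖ = 1 := by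
    have := Complex.norm_exp_ofReal_mul_I (l * ‖y - c‖)
    rw [← this]; congr 2; push_cast; ring
  have e2 : ‖Complex.exp (-(Complex.I * (l : ℂ) * ((‖y - c‖ : ℝ) : ℂ)))‖ = 1 := by
    have := Complex.norm_exp_ofReal_mul_I (-(l * ‖y - c‖))
    rw [← this]; congr 2; push_cast; ring
  have e3 := norm_sub_le (Complex.exp (Complex.I * (l : ℂ) * ((‖y - c‖ : ℝ) : ℂ)))
    (Complex.exp (-(Complex.I * (l : ℂ) * ((‖y - c‖ : ℝ) : ℂ))))
  rw [e1, e2] at e3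
  unfold KK
  rw [norm_div, norm_mul, Complex.norm_real, Complex.norm_real, norm_norm,
    Real.norm_of_nonneg (by positivity), ← div_div, ← one_div]
  gcongr
  rw [div_le_one (by positivity)]
  linarith [Real.pi_gt_three]

theorem KK_eq {G : ℂ → ℂ} (h : ∀ z, z * G (z ^ 2) = Complex.sin z)
    (l : ℝ) (c y : (EuclideanSpace ℝ (Fin 3))) (hy : y ≠ c) :
    KK l c y = (2 * Complex.I * l / (4 * Real.pi)) * G (qq l c y) := by
  have hn : ‖y - c‖ ≠ 0 := by simpa [sub_eq_zero] using hy
  have hn' : (‖y - c‖ : ℂ) ≠ 0 := by exact_mod_cast hn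
  have hp : (Real.pi : ℂ) ≠ 0 := by exact_mod_cast Real.pi_ne_zero
  have q : ((l * ‖y - c‖ : ℂ)) ^ 2 = qq l c y := by simp [qq]; ring
  have s := h (l * ‖y - c‖ : ℂ)
  rw [q] at s
  have t := Complex.two_sin (l * ‖y - c‖ : ℂ)
  unfold KK
  rw [show Complex.I * (l : ℂ) * ((‖y - c‖ : ℝ) : ℂ) = (l * ‖y - c‖ : ℂ) * Complex.I by ring,
    ← neg_mul]
  push_cast
  rw [div_eq_iff (by simp [hn', hp])]
  rw [show 2 * Complex.I * l / (4 * Real.pi) * G (qq l c y) * (4 * Real.pi * ‖y - c‖) =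
    2 * Complex.I * (l * ‖y - c‖ * G (qq l c y)) by field_simp, s]
  generalize Complex.exp (-(l * ‖y - c‖ : ℂ) * Complex.I) = A at *
  generalize Complex.exp ((l * ‖y - c‖ : ℂ) * Complex.I) = B at *
  linear_combination (-Complex.I) * t - (A - B) * Complex.I_sq

theorem KK_bound (l : ℝ) (c : (EuclideanSpace ℝ (Fin 3))) (s : Set (EuclideanSpace ℝ (Fin 3))) (hs : IsCompact s) (w : (EuclideanSpace ℝ (Fin 3)) → ℂ) (M : ℝ)
    (hM : ∀ y, ‖w y‖ ≤ M) (hw : ∀ y, y ∉ s → w y = 0) :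
    ‖∫ y, KK l c y * w y‖ ≤ M * ∫ y in s, ‖y - c‖⁻¹ := by
  rw [← integral_const_mul, ← integral_indicator hs.measurableSet]
  refine norm_integral_le_of_norm_le
    ((integrable_indicator_iff hs.measurableSet).2 ((intOn_inv c s hs).const_mul M))
    (Filter.Eventually.of_forall fun y => ?_)
  by_cases hy : y ∈ s
  · rw [Set.indicator_of_mem hy, norm_mul, mul_comm]
    exact mul_le_mul (hM y) (KK_norm l c y) (norm_nonneg _) ((norm_nonneg _).trans (hM y))
  · simp [hy, hw y hy]

noncomputable def LL (u : (EuclideanSpace ℝ (Fin 3)) → ℂ) (y : (EuclideanSpace ℝ (Fin 3))) : ℂ :=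
  ∑ i : Fin 3, fderiv ℝ (fun x => fderiv ℝ u x (EuclideanSpace.single i 1)) y
    (EuclideanSpace.single i 1)

theorem DD_cont {u : (EuclideanSpace ℝ (Fin 3)) → ℂ} (hu : ContDiff ℝ 2 u) (v : (EuclideanSpace ℝ (Fin 3))) :
    Continuous (fun y => fderiv ℝ (fun x => fderiv ℝ u x v) y v) := by
  have h1 : ContDiff ℝ 1 (fun x => fderiv ℝ u x v) :=
    (hu.fderiv_right (m := 1) (by norm_num)).clm_apply contDiff_const
  exact (h1.continuous_fderiv (by norm_num)).clm_apply continuous_const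

theorem key {u : (EuclideanSpace ℝ (Fin 3)) → ℂ} (hu : ContDiff ℝ 2 u) (hsupp : HasCompactSupport u)
    (l : ℝ) (hl : 0 < l) (c : (EuclideanSpace ℝ (Fin 3))) :
    ∫ y, KK l c y * LL u y = - l ^ 2 * ∫ y, KK l c y * u y := by
  obtain ⟨G, hG, h⟩ := exists_G
  have hF : ContDiff ℝ 2 (fun y => G (qq l c y)) :=
    (hG.contDiff.restrict_scalars ℝ).comp (qq_contDiff l c)
  have hae : ∀ᵐ y : (EuclideanSpace ℝ (Fin 3)), y ≠ c := by simp [ae_iff]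
  have hs2 : ∀ v : (EuclideanSpace ℝ (Fin 3)), HasCompactSupport (fun y => fderiv ℝ (fun x => fderiv ℝ u x v) y v) :=
    fun v => (hsupp.fderiv_apply ℝ v).fderiv_apply ℝ v
  have e : ∀ w : (EuclideanSpace ℝ (Fin 3)) → ℂ, ∫ y, KK l c y * w y =
      (2 * Complex.I * l / (4 * Real.pi)) * ∫ y, G (qq l c y) * w y := by
    intro w
    rw [← integral_const_mul]
    refine integral_congr_ae ?_
    filter_upwards [hae] with y hy
    rw [KK_eq h l c y hy]; ring
  rw [e, e]
  have m : ∫ y, G (qq l c y) * LL u y = - l ^ 2 * ∫ y, G (qq l c y) * u y := by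
    calc ∫ y, G (qq l c y) * LL u y
        = ∑ i : Fin 3, ∫ y, G (qq l c y) * fderiv ℝ (fun x => fderiv ℝ u x
            (EuclideanSpace.single i 1)) y (EuclideanSpace.single i 1) := by
          rw [← integral_finsetSum]
          · simp [LL, Finset.mul_sum]
          · intro i _
            exact (hF.continuous.mul (DD_cont hu _)).integrable_of_hasCompactSupport
              (hs2 _).mul_left
      _ = ∑ i : Fin 3, ∫ y, fderiv ℝ (fun x => fderiv ℝ (fun y => G (qq l c y)) x
            (EuclideanSpace.single i 1)) y (EuclideanSpace.single i 1) * u y :=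
          Finset.sum_congr rfl fun i _ => parts hF hu hsupp _
      _ = ∫ y, (- l ^ 2) * (G (qq l c y) * u y) := by
          rw [← integral_finsetSum]
          · refine integral_congr_ae ?_
            filter_upwards [hae] with y hy
            rw [← Finset.sum_mul, lap hG h l hl c y hy]; ring
          · intro i _
            exact ((DD_cont hF _).mul hu.continuous).integrable_of_hasCompactSupport
              hsupp.mul_left
      _ = _ := by rw [integral_const_mul]
  rw [m]; ring

theorem stmt_19 (u : EuclideanSpace ℝ (Fin 3) → ℂ) (hu : ContDiff ℝ (⊤ : ℕ∞) u)
    (hsupp : HasCompactSupport u) :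
    ∃ C > (0:ℝ), ∀ (y₀ : EuclideanSpace ℝ (Fin 3)) (ε : ℝ), 0 < ε → ∀ l : ℝ, 0 < l →
      ‖∫ y : EuclideanSpace ℝ (Fin 3),
          (Complex.exp (Complex.I * (l : ℂ) * ((‖y - ε⁻¹ • y₀‖ : ℝ) : ℂ)) -
              Complex.exp (-(Complex.I * (l : ℂ) * ((‖y - ε⁻¹ • y₀‖ : ℝ) : ℂ))))
            / (((4 * Real.pi : ℝ) : ℂ) * ((‖y - ε⁻¹ • y₀‖ : ℝ) : ℂ)) * u y‖
        ≤ C * (1 + l ^ 2)⁻¹ * ∫ y in tsupport u, ‖y - ε⁻¹ • y₀‖⁻¹ := by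
  have hu2 : ContDiff ℝ 2 u := hu.of_le (WithTop.coe_le_coe.2 (le_top : (2 : ℕ∞) ≤ ⊤))
  have hL : Continuous (LL u) := continuous_finsetSum _ fun i _ => DD_cont hu2 _
  have hLs : ∀ y, y ∉ tsupport u → LL u y = 0 := by
    intro y hy
    refine Finset.sum_eq_zero fun i _ => ?_
    have h1 := (tsupport_fderiv_apply_subset (f := fun x => fderiv ℝ u x
      (EuclideanSpace.single i 1)) ℝ (EuclideanSpace.single i 1)).trans
      (tsupport_fderiv_apply_subset (f := u) ℝ (EuclideanSpace.single i 1))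
    exact image_eq_zero_of_notMem_tsupport (f := fun y => fderiv ℝ (fun x => fderiv ℝ u x
      (EuclideanSpace.single i 1)) y (EuclideanSpace.single i 1)) fun h => hy (h1 h)
  obtain ⟨M, hM⟩ := hsupp.exists_bound_of_continuous hu.continuous
  obtain ⟨N, hN⟩ := (HasCompactSupport.intro hsupp hLs).exists_bound_of_continuous hL
  have hM0 := (norm_nonneg _).trans (hM 0)
  have hN0 := (norm_nonneg _).trans (hN 0)
  refine ⟨M + N + 1, by positivity, fun y₀ ε _ l hl => ?_⟩
  change ‖∫ y, KK l (ε⁻¹ • y₀) y * u y‖ ≤ _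
  generalize ε⁻¹ • y₀ = c
  have b1 := KK_bound l c _ hsupp u M hM fun y hy => image_eq_zero_of_notMem_tsupport hy
  have b2 := KK_bound l c _ hsupp (LL u) N hN hLs
  rw [key hu2 hsupp l hl c, norm_mul, norm_neg, norm_pow, Complex.norm_real,
    Real.norm_of_nonneg hl.le] at b2
  have J : 0 ≤ ∫ y in tsupport u, ‖y - c‖⁻¹ := integral_nonneg fun y => by positivity
  rw [mul_right_comm, ← div_eq_mul_inv, le_div_iff₀ (by positivity)]
  nlinarith
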